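/- Let γ = (ξ,η) ∈ 𝒢, let D, T ∈ ℕ*, and let α = (α₀,α₁,α₂) ∈ ℂ³ with ‖α‖ = 1 and dist(α,(1:γ)) ≤ (2c₂(γ))⁻¹ (so that α₀ ≠ 0). Then |I^{(γ,T)}_D|_α ≤ c₄^D·(dist(α,(1:γ))^T + dist(α,A_γ)), where c₄ = 3c₂(γ)·exp(2c₂(γ)²). -/

import Mathlib

open MvPolynomial

/-- The derivation `𝒟 = X₀·∂/∂X₁ + X₂·∂/∂X₂` of `ℂ[X₀,X₁,X₂]`. -/
noncomputable def DD : MvPolynomial (Fin 3) ℂ → MvPolynomial (Fin 3) ℂ :=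
  fun P => X 0 * pderiv 1 P + X 2 * pderiv 2 P

/-- The norm of a polynomial: the max of the absolute values of its coefficients. -/
noncomputable def pnorm (P : MvPolynomial (Fin 3) ℂ) : ℝ :=
  ((P.support.sup fun v => ‖P.coeff v‖₊ : NNReal) : ℝ)

/-- The length of a polynomial: the sum of the absolute values of its coefficients. -/
noncomputable def plen (P : MvPolynomial (Fin 3) ℂ) : ℝ :=
  ∑ v ∈ P.support, ‖P.coeff v‖

/-- The automorphism `τ_γ` of `ℂ[X₀,X₁,X₂]`, `τ_γ(P)(X₀,X₁,X₂) = P(X₀, ξX₀+X₁, ηX₂)`. -/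
noncomputable def tauG (ξ η : ℂ) : MvPolynomial (Fin 3) ℂ →ₐ[ℂ] MvPolynomial (Fin 3) ℂ :=
  aeval ![X 0, C ξ * X 0 + X 1, C η * X 2]

/-- The ideal `I^{(γ,T)}` generated by the homogeneous polynomials all of whose
derivatives `𝒟^i P`, `0 ≤ i < T`, vanish at `(1,ξ,η)`. -/
noncomputable def Igam (ξ η : ℂ) (T : ℕ) : Ideal (MvPolynomial (Fin 3) ℂ) :=
  Ideal.span {P | (∃ d, P.IsHomogeneous d) ∧ ∀ i < T, eval ![1, ξ, η] (DD^[i] P) = 0}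

noncomputable def c2c (ξ η : ℂ) : ℝ := max 1 (max ‖ξ‖ ‖η‖)

noncomputable def c3c (ξ η : ℂ) : ℝ := (2 + ‖ξ‖ + ‖η‖⁻¹) * c2c ξ η

noncomputable def c4c (ξ η : ℂ) : ℝ := 3 * c2c ξ η * Real.exp (2 * (c2c ξ η) ^ 2)

noncomputable def c5c (ξ η : ℂ) : ℝ := (2 * c2c ξ η + 3) * (c3c ξ η) ^ 2

/-- Projective distance from `α` (of norm 1) to the point `(1:ξ:η)`. -/
noncomputable def pdist (ξ η α₀ α₁ α₂ : ℂ) : ℝ :=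
  (c2c ξ η)⁻¹ * max ‖α₁ - α₀ * ξ‖ (max ‖α₂ - α₀ * η‖ ‖α₁ * η - α₂ * ξ‖)

/-- Distance from `α` to the analytic curve `A_γ = {(1:ξ+z:ηe^z)}`. -/
noncomputable def adist (ξ η α₀ α₁ α₂ : ℂ) : ℝ :=
  ‖α₂ / α₀ - η * Complex.exp (α₁ / α₀ - ξ)‖

/-- `|I^{(γ,T)}_D|_α = sup{|P(α)| : P ∈ I^{(γ,T)}_D, ‖P‖ ≤ 1}`. -/
noncomputable def Isup (ξ η : ℂ) (T D : ℕ) (α : Fin 3 → ℂ) : ℝ :=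
  sSup {x : ℝ | ∃ P : MvPolynomial (Fin 3) ℂ,
    P ∈ Igam ξ η T ∧ P.IsHomogeneous D ∧ pnorm P ≤ 1 ∧ x = ‖eval α P‖}

open Asymptotics Filter Topology

section Coefficients

lemma norm_coeff_le_pnorm (P : MvPolynomial (Fin 3) ℂ) (v : Fin 3 →₀ ℕ) :
    ‖P.coeff v‖ ≤ pnorm P := by
  by_cases hv : v ∈ P.support
  · have h : ‖P.coeff v‖₊ ≤ P.support.sup fun v => ‖P.coeff v‖₊ :=
      Finset.le_sup (f := fun v => ‖P.coeff v‖₊) hv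
    exact_mod_cast h
  · rw [notMem_support_iff.mp hv, norm_zero]
    exact NNReal.coe_nonneg _

lemma sum_eq_of_mem_support {P : MvPolynomial (Fin 3) ℂ} {D : ℕ} (hP : P.IsHomogeneous D)
    {v : Fin 3 →₀ ℕ} (hv : v ∈ P.support) : v 0 + v 1 + v 2 = D := by
  have h := hP.degree_eq_sum_deg_support hv
  rw [h, ← Finsupp.degree_apply, Finsupp.degree_eq_sum, Fin.sum_univ_three]

lemma card_support_le_three_pow {P : MvPolynomial (Fin 3) ℂ} {D : ℕ} (hP : P.IsHomogeneous D) :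
    P.support.card ≤ 3 ^ D := by
  have hinj : P.support.card ≤ (Finset.piAntidiag (Finset.univ : Finset (Fin 3)) D).card := by
    refine Finset.card_le_card_of_injOn (fun v => (v : Fin 3 → ℕ)) ?_ ?_
    · intro v hv
      have := sum_eq_of_mem_support hP hv
      simp [Fin.sum_univ_three, this]
    · exact fun v _ w _ h => DFunLike.coe_injective h
  refine hinj.trans ?_
  have h := Finset.sum_pow_eq_sum_piAntidiag (Finset.univ : Finset (Fin 3)) (fun _ => (1 : ℕ)) D
  simp only [Finset.sum_const, Finset.card_univ, Fintype.card_fin, smul_eq_mul, mul_one,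
    one_pow, Finset.prod_const_one, Nat.cast_id] at h
  rw [h, Finset.card_eq_sum_ones]
  exact Finset.sum_le_sum fun k _ => Nat.multinomial_pos _ _

/-- A sum of terms of size at most `B`, weighted by the coefficients of a form of norm at most
one, has size at most `3 ^ D * B`. -/
lemma norm_sum_coeff_mul_le {P : MvPolynomial (Fin 3) ℂ} {D : ℕ} (hP : P.IsHomogeneous D)
    (hn : pnorm P ≤ 1) (f : (Fin 3 →₀ ℕ) → ℂ) {B : ℝ}
    (hB : 0 ≤ B) (hf : ∀ v ∈ P.support, ‖f v‖ ≤ B) :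
    ‖∑ v ∈ P.support, P.coeff v * f v‖ ≤ 3 ^ D * B := by
  calc ‖∑ v ∈ P.support, P.coeff v * f v‖ ≤ ∑ _v ∈ P.support, B := by
        refine norm_sum_le_of_le _ fun v hv => ?_
        rw [norm_mul]
        calc ‖P.coeff v‖ * ‖f v‖ ≤ 1 * B :=
              mul_le_mul ((norm_coeff_le_pnorm P v).trans hn) (hf v hv) (norm_nonneg _) zero_le_one
          _ = B := one_mul B
    _ = P.support.card * B := by simp
    _ ≤ 3 ^ D * B := by
        gcongr
        exact_mod_cast card_support_le_three_pow hP

lemma norm_eval_le {P : MvPolynomial (Fin 3) ℂ} {D : ℕ} (hP : P.IsHomogeneous D)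
    (hn : pnorm P ≤ 1) {x : Fin 3 → ℂ} {N : ℝ} (hx : ∀ i, ‖x i‖ ≤ N) :
    ‖eval x P‖ ≤ 3 ^ D * N ^ D := by
  have hN : 0 ≤ N := (norm_nonneg _).trans (hx 0)
  rw [eval_eq']
  refine norm_sum_coeff_mul_le hP hn _ (by positivity) fun v hv => ?_
  rw [norm_prod, ← sum_eq_of_mem_support hP hv, Fin.prod_univ_three, pow_add, pow_add]
  simp only [norm_pow]
  gcongr <;> exact hx _

lemma norm_pow_sub_pow_le_mul_pow {x y : ℂ} {M N : ℝ} (hx : ‖x‖ ≤ M) (hy : ‖y‖ ≤ M)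
    (hMN : M + 1 ≤ N) (n : ℕ) : ‖x ^ n - y ^ n‖ ≤ ‖x - y‖ * N ^ n := by
  have hM : 0 ≤ M := (norm_nonneg x).trans hx
  have hN : 0 ≤ N := by linarith
  induction n with
  | zero => simp
  | succ n ih =>
    have hyN : ‖y‖ ^ n ≤ N ^ n := by gcongr; linarith
    calc ‖x ^ (n + 1) - y ^ (n + 1)‖ = ‖x * (x ^ n - y ^ n) + (x - y) * y ^ n‖ := by ring_nf
      _ ≤ ‖x‖ * ‖x ^ n - y ^ n‖ + ‖x - y‖ * ‖y‖ ^ n := by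
          refine (norm_add_le _ _).trans ?_
          rw [norm_mul, norm_mul, norm_pow]
      _ ≤ M * (‖x - y‖ * N ^ n) + ‖x - y‖ * N ^ n := by gcongr
      _ = (‖x - y‖ * N ^ n) * (M + 1) := by ring
      _ ≤ (‖x - y‖ * N ^ n) * N := by gcongr
      _ = ‖x - y‖ * N ^ (n + 1) := by ring

lemma norm_eval_sub_eval_le {P : MvPolynomial (Fin 3) ℂ} {D : ℕ} (hP : P.IsHomogeneous D)
    (hn : pnorm P ≤ 1) {a b x y : ℂ} {M N : ℝ} (ha : ‖a‖ ≤ 1) (hb : ‖b‖ ≤ 1)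
    (hx : ‖x‖ ≤ M) (hy : ‖y‖ ≤ M) (hMN : M + 1 ≤ N) :
    ‖eval ![a, b, x] P - eval ![a, b, y] P‖ ≤ 3 ^ D * (‖x - y‖ * N ^ D) := by
  have hN : 1 ≤ N := by linarith [norm_nonneg x]
  rw [eval_eq', eval_eq', ← Finset.sum_sub_distrib]
  simp_rw [← mul_sub]
  refine norm_sum_coeff_mul_le hP hn _ (by positivity) fun v hv => ?_
  have hv2 : v 2 ≤ D := by have := sum_eq_of_mem_support hP hv; omega
  simp only [Fin.prod_univ_three, Matrix.cons_val]
  rw [← mul_sub, norm_mul, norm_mul, norm_pow, norm_pow]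
  calc ‖a‖ ^ v 0 * ‖b‖ ^ v 1 * ‖x ^ v 2 - y ^ v 2‖
      ≤ 1 * 1 * (‖x - y‖ * N ^ v 2) := by
        gcongr
        · exact pow_le_one₀ (norm_nonneg _) ha
        · exact pow_le_one₀ (norm_nonneg _) hb
        · exact norm_pow_sub_pow_le_mul_pow hx hy hMN _
    _ ≤ ‖x - y‖ * N ^ D := by
        rw [one_mul, one_mul]
        gcongr

lemma eval_smul_of_isHomogeneous {P : MvPolynomial (Fin 3) ℂ} {D : ℕ} (hP : P.IsHomogeneous D)
    (r : ℂ) (x : Fin 3 → ℂ) : eval (r • x) P = r ^ D * eval x P := by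
  rw [eval_eq', eval_eq', Finset.mul_sum]
  refine Finset.sum_congr rfl fun v hv => ?_
  rw [← sum_eq_of_mem_support hP hv]
  simp only [Fin.prod_univ_three, Pi.smul_apply, smul_eq_mul, mul_pow, pow_add]
  ring

end Coefficients

section Curve

/-- The point `(1, ξ + z, η e^z)` of the analytic curve through `(1, ξ, η)`. -/
noncomputable def curvePt (ξ η z : ℂ) : Fin 3 → ℂ := ![1, ξ + z, η * Complex.exp z]

lemma hasDerivAt_eval_curvePt (ξ η : ℂ) (P : MvPolynomial (Fin 3) ℂ) (z : ℂ) :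
    HasDerivAt (fun w => eval (curvePt ξ η w) P) (eval (curvePt ξ η z) (DD P)) z := by
  induction P using MvPolynomial.induction_on with
  | C a => simpa [DD] using hasDerivAt_const z a
  | add p q hp hq =>
    have h : DD (p + q) = DD p + DD q := by simp only [DD, map_add]; ring
    simpa [h] using hp.fun_add hq
  | mul_X p i hp =>
    have h : DD (p * X i) = DD p * X i + p * DD (X i) := by
      simp only [DD, pderiv_mul]; ring
    have hX : HasDerivAt (fun w => curvePt ξ η w i) (eval (curvePt ξ η z) (DD (X i))) z := by
      fin_cases i
      · simpa [DD, curvePt, pderiv_X] using hasDerivAt_const z (1 : ℂ)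
      · simpa [DD, curvePt, pderiv_X] using (hasDerivAt_id z).const_add ξ
      · simpa [DD, curvePt, pderiv_X] using (Complex.hasDerivAt_exp z).const_mul η
    simpa [h] using hp.fun_mul hX

lemma differentiable_eval_curvePt (ξ η : ℂ) (P : MvPolynomial (Fin 3) ℂ) :
    Differentiable ℂ fun w => eval (curvePt ξ η w) P :=
  fun z => (hasDerivAt_eval_curvePt ξ η P z).differentiableAt

lemma iteratedDeriv_eval_curvePt (ξ η : ℂ) (P : MvPolynomial (Fin 3) ℂ) (n : ℕ) :
    iteratedDeriv n (fun w => eval (curvePt ξ η w) P) =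
      fun w => eval (curvePt ξ η w) (DD^[n] P) := by
  induction n with
  | zero => simp
  | succ n ih =>
    rw [iteratedDeriv_succ, ih, Function.iterate_succ_apply']
    exact funext fun z => (hasDerivAt_eval_curvePt ξ η _ z).deriv

lemma eval_curvePt_isBigO_of_mem_Igam {ξ η : ℂ} {T : ℕ} {P : MvPolynomial (Fin 3) ℂ}
    (hP : P ∈ Igam ξ η T) : (fun w => eval (curvePt ξ η w) P) =O[𝓝 0] fun w : ℂ => w ^ T := by
  induction hP using Submodule.span_induction with
  | mem P hP =>
    have han : AnalyticAt ℂ (fun w => eval (curvePt ξ η w) P) 0 :=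
      (differentiable_eval_curvePt ξ η P).analyticAt 0
    have hord : (T : ℕ∞) ≤ analyticOrderAt (fun w => eval (curvePt ξ η w) P) 0 := by
      rw [natCast_le_analyticOrderAt_iff_iteratedDeriv_eq_zero han]
      intro i hi
      rw [iteratedDeriv_eval_curvePt]
      simpa [curvePt] using hP.2 i hi
    obtain ⟨g, hg, hfg⟩ := (natCast_le_analyticOrderAt han).mp hord
    have h := (isBigO_refl (fun w : ℂ => w ^ T) (𝓝 0)).mul
      (hg.continuousAt.isBigO_one ℂ)
    refine h.congr' ?_ ?_
    · filter_upwards [hfg] with w hw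
      simpa using hw.symm
    · filter_upwards with w
      simp
  | zero => simpa using isBigO_zero _ _
  | add P Q _ _ hP hQ => simpa using hP.add hQ
  | smul a P _ hP =>
    have ha := (differentiable_eval_curvePt ξ η a).continuous.continuousAt (x := 0)
    have h := (ha.isBigO_one ℂ).mul hP
    simpa using h

/-- Schwarz lemma with multiplicity along the curve. -/
lemma norm_eval_curvePt_le {ξ η : ℂ} {T : ℕ} (hT : 0 < T) {P : MvPolynomial (Fin 3) ℂ}
    (hP : P ∈ Igam ξ η T) {R B : ℝ}
    (hB : ∀ w : ℂ, ‖w‖ < R → ‖eval (curvePt ξ η w) P‖ ≤ B) {z : ℂ} (hz : ‖z‖ < R) :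
    ‖eval (curvePt ξ η z) P‖ ≤ B * (‖z‖ / R) ^ T := by
  obtain ⟨n, rfl⟩ : ∃ n, T = n + 1 := ⟨T - 1, by omega⟩
  have ho : (fun w => eval (curvePt ξ η w) P) =o[𝓝 0] fun w : ℂ => w ^ n :=
    (eval_curvePt_isBigO_of_mem_Igam hP).trans_isLittleO (isLittleO_pow_pow n.lt_succ_self)
  have h0 : eval (curvePt ξ η 0) P = 0 := by
    have h := (eval_curvePt_isBigO_of_mem_Igam hP).eq_zero_imp.self_of_nhds
    exact h (zero_pow n.succ_ne_zero)
  have h := Complex.dist_le_mul_div_pow_of_mapsTo_ball_of_isLittleO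
    (f := fun w => eval (curvePt ξ η w) P) (c := 0) (z := z) (R₁ := R) (R₂ := B) (n := n)
    (differentiable_eval_curvePt ξ η P).differentiableOn
    (fun w hw => by simpa [h0] using hB w (by simpa using hw))
    (by simpa [h0] using ho.norm_right) (by simpa using hz)
  simpa [h0] using h

end Curve

section Constants

lemma one_le_c2c (ξ η : ℂ) : 1 ≤ c2c ξ η := le_max_left _ _

lemma norm_fst_le_c2c (ξ η : ℂ) : ‖ξ‖ ≤ c2c ξ η := (le_max_left _ _).trans (le_max_right _ _)

lemma norm_snd_le_c2c (ξ η : ℂ) : ‖η‖ ≤ c2c ξ η := (le_max_right _ _).trans (le_max_right _ _)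

lemma norm_curvePt_le {ξ η w : ℂ} (hw : ‖w‖ ≤ 2 * c2c ξ η ^ 2) (i : Fin 3) :
    ‖curvePt ξ η w i‖ ≤ c2c ξ η * Real.exp (2 * c2c ξ η ^ 2) := by
  have hc := one_le_c2c ξ η
  have hξ := norm_fst_le_c2c ξ η
  have hη := norm_snd_le_c2c ξ η
  set c := c2c ξ η
  have he : 2 * c ^ 2 + 1 ≤ Real.exp (2 * c ^ 2) := Real.add_one_le_exp _
  fin_cases i
  · simp only [curvePt, Fin.zero_eta, Matrix.cons_val, norm_one]
    nlinarith
  · simp only [curvePt, Fin.mk_one, Matrix.cons_val]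
    calc ‖ξ + w‖ ≤ c + 2 * c ^ 2 := (norm_add_le _ _).trans (by linarith)
      _ ≤ c * (2 * c ^ 2 + 1) := by nlinarith [sq_nonneg c]
      _ ≤ _ := by gcongr
  · simp only [curvePt, Fin.reduceFinMk, Matrix.cons_val, norm_mul]
    gcongr
    exact (Complex.norm_exp_le_exp_norm w).trans (Real.exp_le_exp.mpr hw)

lemma c4c_eq (ξ η : ℂ) : c4c ξ η = 3 * (c2c ξ η * Real.exp (2 * c2c ξ η ^ 2)) := by
  rw [c4c, mul_assoc]

lemma mul_exp_add_one_le {c : ℝ} (hc : 1 ≤ c) :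
    c * Real.exp c + 1 ≤ c * Real.exp (2 * c ^ 2) := by
  have h₁ : c + 1 ≤ Real.exp c := Real.add_one_le_exp c
  have h₂ : Real.exp (2 * c) ≤ Real.exp (2 * c ^ 2) := Real.exp_le_exp.mpr (by nlinarith)
  have h₃ : Real.exp (2 * c) = Real.exp c * Real.exp c := by rw [← Real.exp_add]; ring_nf
  nlinarith

end Constants

section Distance

variable {ξ η α₀ α₁ α₂ : ℂ}

lemma pdist_nonneg : 0 ≤ pdist ξ η α₀ α₁ α₂ :=
  mul_nonneg (inv_nonneg.mpr (zero_le_one.trans (one_le_c2c ξ η)))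
    ((norm_nonneg _).trans (le_max_left _ _))

lemma max_norm_le_c2c_mul_pdist :
    max ‖α₁ - α₀ * ξ‖ (max ‖α₂ - α₀ * η‖ ‖α₁ * η - α₂ * ξ‖) ≤
      c2c ξ η * pdist ξ η α₀ α₁ α₂ := by
  rw [pdist, mul_inv_cancel_left₀ (zero_lt_one.trans_le (one_le_c2c ξ η)).ne']

lemma one_le_two_mul_c2c_mul_norm (hα : max ‖α₀‖ (max ‖α₁‖ ‖α₂‖) = 1)
    (hd : pdist ξ η α₀ α₁ α₂ ≤ (2 * c2c ξ η)⁻¹) : 1 ≤ 2 * c2c ξ η * ‖α₀‖ := by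
  have hc := one_le_c2c ξ η
  have hm := max_norm_le_c2c_mul_pdist (ξ := ξ) (η := η) (α₀ := α₀) (α₁ := α₁) (α₂ := α₂)
  have hhalf : c2c ξ η * pdist ξ η α₀ α₁ α₂ ≤ 1 / 2 := by
    calc _ ≤ c2c ξ η * (2 * c2c ξ η)⁻¹ := by gcongr
      _ = 1 / 2 := by field_simp
  have h₁ : ‖α₁‖ ≤ 1 / 2 + ‖α₀‖ * c2c ξ η := by
    calc ‖α₁‖ = ‖(α₁ - α₀ * ξ) + α₀ * ξ‖ := by ring_nf
      _ ≤ ‖α₁ - α₀ * ξ‖ + ‖α₀‖ * ‖ξ‖ := (norm_add_le _ _).trans_eq (by rw [norm_mul])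
      _ ≤ _ := by
        gcongr
        · exact (le_max_left _ _).trans (hm.trans hhalf)
        · exact norm_fst_le_c2c ξ η
  have h₂ : ‖α₂‖ ≤ 1 / 2 + ‖α₀‖ * c2c ξ η := by
    calc ‖α₂‖ = ‖(α₂ - α₀ * η) + α₀ * η‖ := by ring_nf
      _ ≤ ‖α₂ - α₀ * η‖ + ‖α₀‖ * ‖η‖ := (norm_add_le _ _).trans_eq (by rw [norm_mul])
      _ ≤ _ := by
        gcongr
        · exact ((le_max_left _ _).trans (le_max_right _ _)).trans (hm.trans hhalf)
        · exact norm_snd_le_c2c ξ η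
  have h₀ : ‖α₀‖ ≤ 1 / 2 + ‖α₀‖ * c2c ξ η := by nlinarith [norm_nonneg α₀]
  have := max_le h₀ (max_le h₁ h₂)
  rw [hα] at this
  linarith

lemma norm_div_sub_le (hα : max ‖α₀‖ (max ‖α₁‖ ‖α₂‖) = 1)
    (hd : pdist ξ η α₀ α₁ α₂ ≤ (2 * c2c ξ η)⁻¹) :
    ‖α₁ / α₀ - ξ‖ ≤ 2 * c2c ξ η ^ 2 * pdist ξ η α₀ α₁ α₂ := by
  have hc := one_le_c2c ξ η
  have h := one_le_two_mul_c2c_mul_norm hα hd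
  have h₀ : 0 < ‖α₀‖ := by
    by_contra! hneg
    nlinarith
  have hm := (le_max_left _ _).trans
    (max_norm_le_c2c_mul_pdist (ξ := ξ) (η := η) (α₀ := α₀) (α₁ := α₁) (α₂ := α₂))
  have hne : α₀ ≠ 0 := norm_pos_iff.mp h₀
  have heq : α₁ / α₀ - ξ = (α₁ - α₀ * ξ) / α₀ := by field_simp
  rw [heq, norm_div, div_le_iff₀ h₀]
  have hcd : 0 ≤ c2c ξ η * pdist ξ η α₀ α₁ α₂ := mul_nonneg (by linarith) pdist_nonneg
  nlinarith [mul_le_mul_of_nonneg_left h hcd]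

end Distance

theorem stmt11 (ξ η : ℂ) (hη : η ≠ 0) (D T : ℕ) (hD : 0 < D) (hT : 0 < T)
    (α₀ α₁ α₂ : ℂ) (hα : max ‖α₀‖ (max ‖α₁‖ ‖α₂‖) = 1)
    (hd : pdist ξ η α₀ α₁ α₂ ≤ (2 * c2c ξ η)⁻¹) :
    Isup ξ η T D ![α₀, α₁, α₂] ≤
      c4c ξ η ^ D * (pdist ξ η α₀ α₁ α₂ ^ T + adist ξ η α₀ α₁ α₂) := by
  have hc := one_le_c2c ξ η
  have h₀ := one_le_two_mul_c2c_mul_norm hα hd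
  have hz := norm_div_sub_le hα hd
  have hp : 0 ≤ pdist ξ η α₀ α₁ α₂ := pdist_nonneg
  have hηc := norm_snd_le_c2c ξ η
  have hne : α₀ ≠ 0 := by
    rintro rfl
    norm_num at h₀
  have hα₀ : ‖α₀‖ ≤ 1 := hα ▸ le_max_left _ _
  have hα₁ : ‖α₁‖ ≤ 1 := hα ▸ (le_max_left _ _).trans (le_max_right _ _)
  have hα₂ : ‖α₂‖ ≤ 1 := hα ▸ (le_max_right _ _).trans (le_max_right _ _)
  rw [c4c_eq]
  unfold adist
  set z := α₁ / α₀ - ξ with hzdef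
  set c := c2c ξ η
  set d := pdist ξ η α₀ α₁ α₂
  set N := c * Real.exp (2 * c ^ 2)
  have hN : 0 ≤ N := by positivity
  have hzc : ‖z‖ ≤ c := by
    calc ‖z‖ ≤ 2 * c ^ 2 * (2 * c)⁻¹ := hz.trans (by gcongr)
      _ = c := by field_simp
  have hzR : ‖z‖ < 2 * c ^ 2 := by nlinarith
  refine Real.sSup_le ?_ (by positivity)
  rintro x ⟨P, hPI, hPD, hPn, rfl⟩
  have hpt : ![α₀, α₁, α₀ * (η * Complex.exp z)] = α₀ • curvePt ξ η z := by
    ext i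
    fin_cases i
    · simp [curvePt]
    · simp [curvePt, hzdef, mul_div_cancel₀ _ hne]
    · simp [curvePt]
  have hcurve : ‖eval ![α₀, α₁, α₀ * (η * Complex.exp z)] P‖ ≤ (3 * N) ^ D * d ^ T := by
    rw [hpt, eval_smul_of_isHomogeneous hPD, norm_mul, norm_pow]
    have h := norm_eval_curvePt_le hT hPI (R := 2 * c ^ 2) (B := 3 ^ D * N ^ D)
      (fun w hw => norm_eval_le hPD hPn (norm_curvePt_le hw.le)) hzR
    have hdiv : ‖z‖ / (2 * c ^ 2) ≤ d := by
      rw [div_le_iff₀ (by positivity)]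
      linarith
    calc ‖α₀‖ ^ D * ‖eval (curvePt ξ η z) P‖
        ≤ 1 * (3 ^ D * N ^ D * (‖z‖ / (2 * c ^ 2)) ^ T) := by
          gcongr
          exact pow_le_one₀ (norm_nonneg _) hα₀
      _ ≤ 1 * (3 ^ D * N ^ D * d ^ T) := by gcongr
      _ = (3 * N) ^ D * d ^ T := by rw [one_mul, mul_pow 3 N]
  have hβ : ‖α₀ * (η * Complex.exp z)‖ ≤ c * Real.exp c := by
    rw [norm_mul, norm_mul]
    calc ‖α₀‖ * (‖η‖ * ‖Complex.exp z‖) ≤ 1 * (c * Real.exp c) := by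
          gcongr
          exact (Complex.norm_exp_le_exp_norm z).trans (Real.exp_le_exp.mpr hzc)
      _ = _ := one_mul _
  have hone : 1 ≤ c * Real.exp c := by nlinarith [Real.add_one_le_exp c]
  have hdiff := norm_eval_sub_eval_le hPD hPn hα₀ hα₁ (hα₂.trans hone) hβ (mul_exp_add_one_le hc)
  have hsub : ‖α₂ - α₀ * (η * Complex.exp z)‖ ≤ ‖α₂ / α₀ - η * Complex.exp z‖ := by
    have heq : α₂ - α₀ * (η * Complex.exp z) = α₀ * (α₂ / α₀ - η * Complex.exp z) := by
      field_simp
    rw [heq, norm_mul]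
    exact mul_le_of_le_one_left (norm_nonneg _) hα₀
  calc ‖eval ![α₀, α₁, α₂] P‖
      ≤ ‖eval ![α₀, α₁, α₀ * (η * Complex.exp z)] P‖ +
        ‖eval ![α₀, α₁, α₂] P - eval ![α₀, α₁, α₀ * (η * Complex.exp z)] P‖ :=
        norm_le_norm_add_norm_sub' _ _
    _ ≤ (3 * N) ^ D * d ^ T + 3 ^ D * (‖α₂ / α₀ - η * Complex.exp z‖ * N ^ D) :=
        add_le_add hcurve (hdiff.trans (by gcongr))
    _ = (3 * N) ^ D * (d ^ T + ‖α₂ / α₀ - η * Complex.exp z‖) := by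
        rw [mul_pow]; ring
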